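/- For every positive integer q, the sum over divisors a of q of a·φ(a)·φ(q/a) equals φ(q) times the sum over divisors a of q of (a/gcd(a,q/a))·φ(gcd(a,q/a)). -/

import Mathlib

theorem stmt1 (q : ℕ) (hq : 0 < q) :
    ∑ a ∈ q.divisors, a * Nat.totient a * Nat.totient (q / a)
      = Nat.totient q *
        ∑ a ∈ q.divisors,
          (a / Nat.gcd a (q / a)) * Nat.totient (Nat.gcd a (q / a)) := by
  rw [Finset.mul_sum]
  refine Finset.sum_congr rfl fun a ha => ?_
  have had : a ∣ q := Nat.dvd_of_mem_divisors ha
  have h := Nat.totient_gcd_mul_totient_mul a (q / a)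
  rw [Nat.mul_div_cancel' had] at h
  have hg : a / Nat.gcd a (q / a) * Nat.gcd a (q / a) = a :=
    Nat.div_mul_cancel (Nat.gcd_dvd_left _ _)
  generalize Nat.gcd a (q / a) = g at *
  calc a * Nat.totient a * Nat.totient (q / a)
      = (a / g * g) * Nat.totient a * Nat.totient (q / a) := by rw [hg]
    _ = a / g * (Nat.totient a * Nat.totient (q / a) * g) := by ring
    _ = Nat.totient q * (a / g * Nat.totient g) := by rw [← h]; ring
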